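/- Let k ≥ 1, N_0 ≥ k and n ≥ 0 be integers and set N = N_0 + n + 1. Then binom(N + k, k) / (N · binom(n + k, k)) ≤ binom(N_0 + k, k), i.e. (n + 1 + N_0 + k)(n + N_0 + k)···(n + N_0 + 2) ≤ binom(N_0 + k, k) · (n + k)(n + k − 1)···(n + 1) · (N_0 + n + 1). -/

import Mathlib

theorem Nat.choose_add_succ_mul (m k : ℕ) :
    (m + 1 + k).choose k * (m + 1) = (m + k).choose k * (m + 1 + k) := by
  have h := Nat.choose_mul_succ_eq (m + k) k
  rw [show m + k + 1 - k = m + 1 by omega, show m + k + 1 = m + 1 + k by omega] at h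
  exact h.symm

theorem Nat.choose_add_add_one_le_mul (k a n : ℕ) (h : k ≤ a * (a + 1)) :
    (a + n + 1 + k).choose k ≤ (a + k).choose k * ((a + n + 1) * (n + k).choose k) := by
  induction n with
  | zero =>
    have e := Nat.choose_add_succ_mul a k
    simp only [add_zero, zero_add, Nat.choose_self, mul_one]
    refine Nat.le_of_mul_le_mul_right ?_ a.succ_pos
    rw [Nat.succ_eq_add_one, e, mul_assoc]
    exact Nat.mul_le_mul_left _ (by nlinarith)
  | succ n ih =>
    have e₁ := Nat.choose_add_succ_mul (a + n + 1) k
    have e₂ := Nat.choose_add_succ_mul n k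
    rw [← add_assoc a n 1]
    set c := (a + k).choose k
    set b := (n + k).choose k
    have hf : (a + n + 1) * ((a + n + 1 + 1 + k) * (n + 1)) ≤
        (a + n + 1 + 1) * ((a + n + 1 + 1) * (n + 1 + k)) :=
      Nat.mul_le_mul (Nat.le_succ _) (by nlinarith [Nat.zero_le (k * (a + 1))])
    refine Nat.le_of_mul_le_mul_right (c := (a + n + 1 + 1) * (n + 1)) ?_ (by positivity)
    calc (a + n + 1 + 1 + k).choose k * ((a + n + 1 + 1) * (n + 1))
        = (a + n + 1 + k).choose k * ((a + n + 1 + 1 + k) * (n + 1)) := by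
          rw [← mul_assoc, e₁, mul_assoc]
      _ ≤ c * ((a + n + 1) * b) * ((a + n + 1 + 1 + k) * (n + 1)) :=
          Nat.mul_le_mul_right _ ih
      _ = c * b * ((a + n + 1) * ((a + n + 1 + 1 + k) * (n + 1))) := by ring
      _ ≤ c * b * ((a + n + 1 + 1) * ((a + n + 1 + 1) * (n + 1 + k))) :=
          Nat.mul_le_mul_left _ hf
      _ = c * ((a + n + 1 + 1) * (a + n + 1 + 1)) * (b * (n + 1 + k)) := by ring
      _ = c * ((a + n + 1 + 1) * (n + 1 + k).choose k) * ((a + n + 1 + 1) * (n + 1)) := by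
          rw [← e₂]; ring

/-- Let `k ≥ 1`, `N₀ ≥ k`, `n ≥ 0` be integers and set `N = N₀ + n + 1`.  Then
`binom(N + k, k) / (N · binom(n + k, k)) ≤ binom(N₀ + k, k)` (as rational numbers). -/
theorem stmt17 (k N₀ n : ℕ) (hk : 1 ≤ k) (hN₀ : k ≤ N₀) :
    ((N₀ + n + 1 + k).choose k : ℚ) /
        ((N₀ + n + 1 : ℕ) * ((n + k).choose k : ℚ))
      ≤ ((N₀ + k).choose k : ℚ) := by
  have hb : 0 < (n + k).choose k := Nat.choose_pos (Nat.le_add_left k n)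
  rw [div_le_iff₀ (by positivity)]
  exact_mod_cast Nat.choose_add_add_one_le_mul k N₀ n (by nlinarith)
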